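/- Sum invariance of the energy distance: let P, Q, R be probability measures on ℝ^d with finite first moments, and let P∗R and Q∗R denote convolutions. Then 𝓔(P∗R, Q∗R) ≤ 𝓔(P, Q). In particular, for random variables A independent of X and Y, 𝓔(A + X, A + Y) ≤ 𝓔(X, Y). -/

import Mathlib

open MeasureTheory

/-- The energy distance between probability measures on `ℝ^d`:
`𝓔(P, Q) = 2 E‖X - Y‖ - E‖X - X'‖ - E‖Y - Y'‖`. -/
noncomputable def energyDist {d : ℕ} (P Q : Measure (EuclideanSpace ℝ (Fin d))) : ℝ :=
  2 * (∫ z, ‖z.1 - z.2‖ ∂(P.prod Q))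
    - (∫ z, ‖z.1 - z.2‖ ∂(P.prod P))
    - (∫ z, ‖z.1 - z.2‖ ∂(Q.prod Q))

open ProbabilityTheory ComplexConjugate

/-- The integrand whose integral over `s : ℝ` is a fixed positive multiple of `r`. -/
noncomputable def gaussianDefect (s r : ℝ) : ℝ := (1 - Real.exp (-(s * r) ^ 2 / 2)) / s ^ 2

lemma gaussianDefect_nonneg (s r : ℝ) : 0 ≤ gaussianDefect s r := by
  refine div_nonneg ?_ (sq_nonneg s)
  rw [sub_nonneg, Real.exp_le_one_iff]
  nlinarith [sq_nonneg (s * r)]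

lemma measurable_gaussianDefect : Measurable (fun p : ℝ × ℝ => gaussianDefect p.1 p.2) := by
  unfold gaussianDefect
  fun_prop

lemma gaussianDefect_one_le (s : ℝ) : gaussianDefect s 1 ≤ 2 * (1 + s ^ 2)⁻¹ := by
  unfold gaussianDefect
  rcases eq_or_ne s 0 with rfl | hs
  · simp
  have hs2 : 0 < s ^ 2 := by positivity
  have h1 := Real.exp_pos (-(s * 1) ^ 2 / 2)
  have h2 := Real.add_one_le_exp (-(s * 1) ^ 2 / 2)
  rw [mul_one] at *
  rw [← div_eq_mul_inv, div_le_div_iff₀ hs2 (by positivity)]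
  nlinarith

lemma integrable_gaussianDefect_one : Integrable (fun s => gaussianDefect s 1) := by
  refine (integrable_inv_one_add_sq.const_mul 2).mono' ?_ (.of_forall fun s => ?_)
  · exact (measurable_gaussianDefect.comp
      (measurable_id.prodMk measurable_const)).aestronglyMeasurable
  · rw [Real.norm_of_nonneg (gaussianDefect_nonneg _ _)]
    exact gaussianDefect_one_le s

lemma integral_gaussianDefect_one_pos : 0 < ∫ s, gaussianDefect s 1 := by
  rw [integral_pos_iff_support_of_nonneg (fun s => gaussianDefect_nonneg s 1)
    integrable_gaussianDefect_one]
  refine lt_of_lt_of_le (b := volume (Set.Ioi (0 : ℝ))) (by simp) (measure_mono fun s hs => ?_)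
  have hs : 0 < s := hs
  refine ne_of_gt (div_pos ?_ (by positivity))
  rw [sub_pos, Real.exp_lt_one_iff]
  have : 0 < (s * 1) ^ 2 := by positivity
  linarith

lemma gaussianDefect_eq (s r : ℝ) : gaussianDefect s r = r ^ 2 * gaussianDefect (r * s) 1 := by
  unfold gaussianDefect
  rcases eq_or_ne r 0 with rfl | hr
  · simp
  rcases eq_or_ne s 0 with rfl | hs
  · simp
  rw [mul_one, mul_comm r s]
  field_simp

lemma integrable_gaussianDefect (r : ℝ) : Integrable (fun s => gaussianDefect s r) := by
  simp_rw [gaussianDefect_eq _ r]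
  rcases eq_or_ne r 0 with rfl | hr
  · simp
  exact (integrable_gaussianDefect_one.comp_mul_left' hr).const_mul _

lemma integral_gaussianDefect {r : ℝ} (hr : 0 ≤ r) :
    ∫ s, gaussianDefect s r = (∫ s, gaussianDefect s 1) * r := by
  simp_rw [gaussianDefect_eq _ r]
  rw [integral_const_mul, Measure.integral_comp_mul_left (fun s => gaussianDefect s 1) r]
  rcases eq_or_ne r 0 with rfl | hr0
  · simp
  rw [abs_of_nonneg (by positivity), smul_eq_mul]
  field_simp

section InnerProductSpace

variable {E : Type*} [NormedAddCommGroup E] [InnerProductSpace ℝ E] [FiniteDimensional ℝ E]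
  [MeasurableSpace E]

lemma integral_prod_exp_inner (P Q : Measure E) [IsProbabilityMeasure P] [IsProbabilityMeasure Q]
    (t : E) :
    ∫ z, Complex.exp (inner ℝ t (z.1 - z.2) * Complex.I) ∂(P.prod Q) =
      charFun P t * conj (charFun Q t) := by
  rw [← charFun_neg, charFun_apply, charFun_apply, ← integral_prod_mul]
  congr with z
  rw [← Complex.exp_add, inner_neg_right, real_inner_comm, inner_sub_left]
  push_cast
  ring_nf

variable [BorelSpace E]

/-- The Gaussian kernel integrates to the `L²` pairing of characteristic functions. -/
lemma integral_prod_exp_neg_sq_norm_sub (P Q : Measure E) [IsProbabilityMeasure P]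
    [IsProbabilityMeasure Q] (s : ℝ) :
    ∫ z, Real.exp (-(s * ‖z.1 - z.2‖) ^ 2 / 2) ∂(P.prod Q) =
      ∫ g, (charFun P (s • g) * conj (charFun Q (s • g))).re ∂(stdGaussian E) := by
  have hexp : Integrable (Function.uncurry fun (z : E × E) (g : E) =>
      Complex.exp (inner ℝ (s • g) (z.1 - z.2) * Complex.I))
      ((P.prod Q).prod (stdGaussian E)) := by
    refine Integrable.of_bound (C := 1) ?_ (.of_forall fun p => ?_)
    · exact (by fun_prop : Continuous (Function.uncurry fun (z : E × E) (g : E) =>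
        Complex.exp (inner ℝ (s • g) (z.1 - z.2) * Complex.I))).aestronglyMeasurable
    · simp [Function.uncurry, Complex.norm_exp_ofReal_mul_I]
  have hK (z : E × E) : ((Real.exp (-(s * ‖z.1 - z.2‖) ^ 2 / 2) : ℝ) : ℂ) =
      ∫ g, Complex.exp (inner ℝ (s • g) (z.1 - z.2) * Complex.I) ∂(stdGaussian E) := by
    have h := charFun_stdGaussian (s • (z.1 - z.2))
    rw [charFun_apply, norm_smul, ← Complex.ofReal_pow, mul_pow, Real.norm_eq_abs, sq_abs,
      ← mul_pow] at h
    simp_rw [real_inner_smul_left, ← real_inner_smul_right]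
    rw [h]
    push_cast
    rfl
  have hswap := integral_integral_swap hexp
  simp_rw [← hK, integral_prod_exp_inner] at hswap
  rw [integral_complex_ofReal] at hswap
  have hpair := hexp.integral_prod_right
  simp only [Function.uncurry, integral_prod_exp_inner] at hpair
  exact (congrArg Complex.re hswap).trans (integral_re hpair).symm

lemma integrable_charFun_mul_conj_charFun (P Q : Measure E) [IsProbabilityMeasure P]
    [IsProbabilityMeasure Q] (s : ℝ) :
    Integrable (fun g => (charFun P (s • g) * conj (charFun Q (s • g))).re) (stdGaussian E) := by
  have hP : Measurable (charFun P) := measurable_charFun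
  have hQ : Measurable (charFun Q) := measurable_charFun
  refine Integrable.of_bound (C := 1) (by fun_prop) (.of_forall fun g => ?_)
  refine (Complex.abs_re_le_norm _).trans ?_
  rw [norm_mul, RCLike.norm_conj]
  exact mul_le_one₀ (norm_charFun_le_one _) (norm_nonneg _) (norm_charFun_le_one _)

lemma integral_prod_gaussianDefect (P Q : Measure E) [IsProbabilityMeasure P]
    [IsProbabilityMeasure Q] (s : ℝ) :
    ∫ z, gaussianDefect s ‖z.1 - z.2‖ ∂(P.prod Q) =
      (1 - ∫ g, (charFun P (s • g) * conj (charFun Q (s • g))).re ∂(stdGaussian E)) / s ^ 2 := by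
  unfold gaussianDefect
  rw [integral_div, integral_sub (integrable_const _), integral_prod_exp_neg_sq_norm_sub]
  · simp
  · refine Integrable.of_bound (C := 1) (by fun_prop) (.of_forall fun z => ?_)
    rw [Real.norm_of_nonneg (Real.exp_pos _).le, Real.exp_le_one_iff]
    nlinarith [sq_nonneg (s * ‖z.1 - z.2‖)]

lemma integrable_prod_norm_sub {P Q : Measure E} [IsProbabilityMeasure P]
    [IsProbabilityMeasure Q] (hP : Integrable (fun x => ‖x‖) P) (hQ : Integrable (fun y => ‖y‖) Q) :
    Integrable (fun z : E × E => ‖z.1 - z.2‖) (P.prod Q) := by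
  refine ((hP.comp_fst Q).add (hQ.comp_snd P)).mono' (by fun_prop) (.of_forall fun z => ?_)
  simpa using norm_sub_le z.1 z.2

lemma integrable_uncurry_gaussianDefect {P Q : Measure E} [IsProbabilityMeasure P]
    [IsProbabilityMeasure Q] (hP : Integrable (fun x => ‖x‖) P) (hQ : Integrable (fun y => ‖y‖) Q) :
    Integrable (Function.uncurry fun (z : E × E) (s : ℝ) => gaussianDefect s ‖z.1 - z.2‖)
      ((P.prod Q).prod volume) := by
  have hmeas : Measurable fun p : (E × E) × ℝ => gaussianDefect p.2 ‖p.1.1 - p.1.2‖ := by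
    unfold gaussianDefect
    fun_prop
  have hnorm (z : E × E) : ∫ s, ‖gaussianDefect s ‖z.1 - z.2‖‖ =
      (∫ s, gaussianDefect s 1) * ‖z.1 - z.2‖ := by
    simp_rw [Real.norm_of_nonneg (gaussianDefect_nonneg _ _)]
    exact integral_gaussianDefect (norm_nonneg _)
  refine (integrable_prod_iff hmeas.aestronglyMeasurable).2
    ⟨.of_forall fun z => integrable_gaussianDefect ‖z.1 - z.2‖, ?_⟩
  simp_rw [hnorm]
  exact (integrable_prod_norm_sub hP hQ).const_mul (∫ s, gaussianDefect s 1)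

lemma integrable_integral_prod_gaussianDefect {P Q : Measure E} [IsProbabilityMeasure P]
    [IsProbabilityMeasure Q] (hP : Integrable (fun x => ‖x‖) P) (hQ : Integrable (fun y => ‖y‖) Q) :
    Integrable (fun s => ∫ z, gaussianDefect s ‖z.1 - z.2‖ ∂(P.prod Q)) :=
  (integrable_uncurry_gaussianDefect hP hQ).integral_prod_right

lemma integral_integral_prod_gaussianDefect {P Q : Measure E} [IsProbabilityMeasure P]
    [IsProbabilityMeasure Q] (hP : Integrable (fun x => ‖x‖) P) (hQ : Integrable (fun y => ‖y‖) Q) :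
    ∫ s, ∫ z, gaussianDefect s ‖z.1 - z.2‖ ∂(P.prod Q) =
      (∫ s, gaussianDefect s 1) * ∫ z, ‖z.1 - z.2‖ ∂(P.prod Q) := by
  rw [← integral_integral_swap (integrable_uncurry_gaussianDefect hP hQ), ← integral_const_mul]
  simp_rw [integral_gaussianDefect (norm_nonneg _)]

lemma integrable_norm_conv {P R : Measure E} [IsProbabilityMeasure P] [IsProbabilityMeasure R]
    (hP : Integrable (fun x => ‖x‖) P) (hR : Integrable (fun a => ‖a‖) R) :
    Integrable (fun x => ‖x‖) (P.conv R) := by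
  rw [Measure.conv, integrable_map_measure (by fun_prop) (by fun_prop)]
  refine ((hP.comp_fst R).add (hR.comp_snd P)).mono' (by fun_prop) (.of_forall fun z => ?_)
  simpa using norm_add_le z.1 z.2

lemma integrable_normSq_charFun_sub (P Q : Measure E) [IsProbabilityMeasure P]
    [IsProbabilityMeasure Q] (s : ℝ) :
    Integrable (fun g => Complex.normSq (charFun P (s • g) - charFun Q (s • g)))
      (stdGaussian E) := by
  refine (((integrable_charFun_mul_conj_charFun P P s).add
    (integrable_charFun_mul_conj_charFun Q Q s)).sub
    ((integrable_charFun_mul_conj_charFun P Q s).const_mul 2)).congr (.of_forall fun g => ?_)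
  simp [Complex.normSq_apply]
  ring

/-- The combination of Gaussian defects defining the energy distance is a weighted `L²` distance
of characteristic functions. -/
lemma gaussianDefect_energy_eq (P Q : Measure E) [IsProbabilityMeasure P]
    [IsProbabilityMeasure Q] (s : ℝ) :
    2 * (∫ z, gaussianDefect s ‖z.1 - z.2‖ ∂(P.prod Q))
      - (∫ z, gaussianDefect s ‖z.1 - z.2‖ ∂(P.prod P))
      - (∫ z, gaussianDefect s ‖z.1 - z.2‖ ∂(Q.prod Q)) =
    (∫ g, Complex.normSq (charFun P (s • g) - charFun Q (s • g)) ∂(stdGaussian E)) / s ^ 2 := by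
  have hPP := integrable_charFun_mul_conj_charFun P P s
  have hQQ := integrable_charFun_mul_conj_charFun Q Q s
  have hPQ := (integrable_charFun_mul_conj_charFun P Q s).const_mul 2
  have h : ∫ g, Complex.normSq (charFun P (s • g) - charFun Q (s • g)) ∂(stdGaussian E) =
      ∫ g, ((charFun P (s • g) * conj (charFun P (s • g))).re +
        (charFun Q (s • g) * conj (charFun Q (s • g))).re -
        2 * (charFun P (s • g) * conj (charFun Q (s • g))).re) ∂(stdGaussian E) := by
    congr with g
    simp [Complex.normSq_apply]
    ring
  rw [h, integral_sub (by exact hPP.add hQQ) hPQ, integral_add hPP hQQ, integral_const_mul]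
  simp_rw [integral_prod_gaussianDefect]
  ring

lemma integral_normSq_charFun_conv_sub_le (P Q R : Measure E) [IsProbabilityMeasure P]
    [IsProbabilityMeasure Q] [IsProbabilityMeasure R] (s : ℝ) :
    ∫ g, Complex.normSq (charFun (P.conv R) (s • g) - charFun (Q.conv R) (s • g))
        ∂(stdGaussian E) ≤
      ∫ g, Complex.normSq (charFun P (s • g) - charFun Q (s • g)) ∂(stdGaussian E) := by
  refine integral_mono (integrable_normSq_charFun_sub _ _ s)
    (integrable_normSq_charFun_sub _ _ s) fun g => ?_
  simp only [charFun_conv, ← sub_mul, Complex.normSq_mul]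
  refine mul_le_of_le_one_right (Complex.normSq_nonneg _) ?_
  rw [Complex.normSq_eq_norm_sq]
  exact pow_le_one₀ (norm_nonneg _) (norm_charFun_le_one _)

end InnerProductSpace

section EnergyDist

variable {d : ℕ} {P Q : Measure (EuclideanSpace ℝ (Fin d))} [IsProbabilityMeasure P]
  [IsProbabilityMeasure Q]

lemma integrable_integral_normSq_charFun_sub_div (hP : Integrable (fun x => ‖x‖) P)
    (hQ : Integrable (fun y => ‖y‖) Q) :
    Integrable (fun s : ℝ => (∫ g, Complex.normSq (charFun P (s • g) - charFun Q (s • g))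
      ∂(stdGaussian (EuclideanSpace ℝ (Fin d)))) / s ^ 2) := by
  simp_rw [← gaussianDefect_energy_eq]
  exact (((integrable_integral_prod_gaussianDefect hP hQ).const_mul 2).sub
    (integrable_integral_prod_gaussianDefect hP hP)).sub
    (integrable_integral_prod_gaussianDefect hQ hQ)

lemma mul_energyDist_eq (hP : Integrable (fun x => ‖x‖) P) (hQ : Integrable (fun y => ‖y‖) Q) :
    (∫ s, gaussianDefect s 1) * energyDist P Q =
      ∫ s : ℝ, (∫ g, Complex.normSq (charFun P (s • g) - charFun Q (s • g))
        ∂(stdGaussian (EuclideanSpace ℝ (Fin d)))) / s ^ 2 := by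
  have hPQ := (integrable_integral_prod_gaussianDefect hP hQ).const_mul 2
  have hPP := integrable_integral_prod_gaussianDefect hP hP
  have hQQ := integrable_integral_prod_gaussianDefect hQ hQ
  simp_rw [← gaussianDefect_energy_eq]
  rw [integral_sub (by exact hPQ.sub hPP) hQQ, integral_sub hPQ hPP, integral_const_mul,
    integral_integral_prod_gaussianDefect hP hQ, integral_integral_prod_gaussianDefect hP hP,
    integral_integral_prod_gaussianDefect hQ hQ, energyDist]
  ring

end EnergyDist

/-- Sum invariance of the energy distance: convolving both `P` and `Q` with `R` does not
increase the energy distance, `𝓔(P∗R, Q∗R) ≤ 𝓔(P, Q)`; i.e. for `A` independent of `X`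
and `Y`, `𝓔(A + X, A + Y) ≤ 𝓔(X, Y)`. -/
theorem energy_sum_invariant {d : ℕ} (P Q R : Measure (EuclideanSpace ℝ (Fin d)))
    [IsProbabilityMeasure P] [IsProbabilityMeasure Q] [IsProbabilityMeasure R]
    (hP : Integrable (fun x => ‖x‖) P) (hQ : Integrable (fun y => ‖y‖) Q)
    (hR : Integrable (fun a => ‖a‖) R) :
    energyDist (Measure.conv P R) (Measure.conv Q R) ≤ energyDist P Q := by
  refine le_of_mul_le_mul_left ?_ integral_gaussianDefect_one_pos
  have hPR := integrable_norm_conv hP hR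
  have hQR := integrable_norm_conv hQ hR
  rw [mul_energyDist_eq hPR hQR, mul_energyDist_eq hP hQ]
  exact integral_mono (integrable_integral_normSq_charFun_sub_div hPR hQR)
    (integrable_integral_normSq_charFun_sub_div hP hQ) fun s =>
      div_le_div_of_nonneg_right (integral_normSq_charFun_conv_sub_le P Q R s) (sq_nonneg s)
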